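/- Let μ ∈ [0,1] and let e₀ = 0, so that q₀(t) = (cos t, sin t). Let q : I → ℝ² be a solution of the circular restricted three-body problem on an open interval I such that ‖q(t) + μ·q₀(t)‖ > 0 and ‖q(t) − (1−μ)·q₀(t)‖ > 0 for all t ∈ I. Then the Jacobi integral is conserved: the function t ↦ J(q(t), q̇(t), t) is constant on I. -/

import Mathlib

/-- Distance from the asteroid `q` to the Sun (at `−μ·q₀(t)` with `q₀(t) = (cos t, sin t)`). -/
noncomputable def d1c (μ : ℝ) (q1 q2 : ℝ → ℝ) (t : ℝ) : ℝ :=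
  Real.sqrt ((q1 t + μ * Real.cos t) ^ 2 + (q2 t + μ * Real.sin t) ^ 2)

/-- Distance from the asteroid `q` to Jupiter (at `(1−μ)·q₀(t)`). -/
noncomputable def d2c (μ : ℝ) (q1 q2 : ℝ → ℝ) (t : ℝ) : ℝ :=
  Real.sqrt ((q1 t - (1 - μ) * Real.cos t) ^ 2 + (q2 t - (1 - μ) * Real.sin t) ^ 2)

/-- The Jacobi integral
`J(q,v,t) = ‖v‖²/2 − (1−μ)/‖q+μq₀‖ − μ/‖q−(1−μ)q₀‖ − (q₁v₂ − q₂v₁)`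
evaluated along the curve `(q,v)` at time `t`, for the circular problem. -/
noncomputable def JacC (μ : ℝ) (q1 q2 v1 v2 : ℝ → ℝ) (t : ℝ) : ℝ :=
  (v1 t ^ 2 + v2 t ^ 2) / 2 - (1 - μ) / d1c μ q1 q2 t - μ / d2c μ q1 q2 t
    - (q1 t * v2 t - q2 t * v1 t)

/-- For the circular restricted three-body problem
(`e₀ = 0`, `q₀(t) = (cos t, sin t)`), along any collision-free solution on an
open interval, the Jacobi integral is conserved. -/
theorem stmt_13 (μ : ℝ) (hμ : μ ∈ Set.Icc (0:ℝ) 1) (a b : ℝ)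
    (q1 q2 v1 v2 : ℝ → ℝ)
    (hpos : ∀ t ∈ Set.Ioo a b, 0 < d1c μ q1 q2 t ∧ 0 < d2c μ q1 q2 t)
    (hq1 : ∀ t ∈ Set.Ioo a b, HasDerivAt q1 (v1 t) t)
    (hq2 : ∀ t ∈ Set.Ioo a b, HasDerivAt q2 (v2 t) t)
    (hv1 : ∀ t ∈ Set.Ioo a b, HasDerivAt v1
      (-(1 - μ) * (q1 t + μ * Real.cos t) / d1c μ q1 q2 t ^ 3
        - μ * (q1 t - (1 - μ) * Real.cos t) / d2c μ q1 q2 t ^ 3) t)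
    (hv2 : ∀ t ∈ Set.Ioo a b, HasDerivAt v2
      (-(1 - μ) * (q2 t + μ * Real.sin t) / d1c μ q1 q2 t ^ 3
        - μ * (q2 t - (1 - μ) * Real.sin t) / d2c μ q1 q2 t ^ 3) t) :
    ∀ t₁ ∈ Set.Ioo a b, ∀ t₂ ∈ Set.Ioo a b,
      JacC μ q1 q2 v1 v2 t₁ = JacC μ q1 q2 v1 v2 t₂ := by
  have key : ∀ t ∈ Set.Ioo a b, HasDerivAt (JacC μ q1 q2 v1 v2) 0 t := by
    intro t ht
    obtain ⟨h1, h2⟩ := hpos t ht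
    have hc := Real.hasDerivAt_cos t
    have hs := Real.hasDerivAt_sin t
    have p1 : (q1 t + μ * Real.cos t) ^ 2 + (q2 t + μ * Real.sin t) ^ 2 ≠ 0 :=
      (Real.sqrt_pos.1 h1).ne'
    have p2 : (q1 t - (1 - μ) * Real.cos t) ^ 2 + (q2 t - (1 - μ) * Real.sin t) ^ 2 ≠ 0 :=
      (Real.sqrt_pos.1 h2).ne'
    have D1 : HasDerivAt (d1c μ q1 q2) _ t :=
      ((((hq1 t ht).add (hc.const_mul μ)).pow 2).add
        (((hq2 t ht).add (hs.const_mul μ)).pow 2)).sqrt p1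
    have D2 : HasDerivAt (d2c μ q1 q2) _ t :=
      ((((hq1 t ht).sub (hc.const_mul (1 - μ))).pow 2).add
        (((hq2 t ht).sub (hs.const_mul (1 - μ))).pow 2)).sqrt p2
    have D1' : HasDerivAt (d1c μ q1 q2)
        (((q1 t + μ * Real.cos t) * (v1 t - μ * Real.sin t)
          + (q2 t + μ * Real.sin t) * (v2 t + μ * Real.cos t)) / d1c μ q1 q2 t) t := by
      refine D1.congr_deriv ?_
      change _ / (2 * d1c μ q1 q2 t) = _
      simp only [Pi.add_apply]
      field_simp
      push_cast
      ring
    have D2' : HasDerivAt (d2c μ q1 q2)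
        (((q1 t - (1 - μ) * Real.cos t) * (v1 t + (1 - μ) * Real.sin t)
          + (q2 t - (1 - μ) * Real.sin t) * (v2 t - (1 - μ) * Real.cos t))
          / d2c μ q1 q2 t) t := by
      refine D2.congr_deriv ?_
      change _ / (2 * d2c μ q1 q2 t) = _
      simp only [Pi.sub_apply]
      field_simp
      push_cast
      ring
    have H := ((((((hv1 t ht).pow 2).add ((hv2 t ht).pow 2)).div_const 2).sub
      ((hasDerivAt_const t (1 - μ)).div D1' h1.ne')).sub
      ((hasDerivAt_const t μ).div D2' h2.ne')).sub
      (((hq1 t ht).mul (hv2 t ht)).sub ((hq2 t ht).mul (hv1 t ht)))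
    refine HasDerivAt.congr_deriv (f := JacC μ q1 q2 v1 v2) H ?_
    generalize d1c μ q1 q2 t = r1 at *
    generalize d2c μ q1 q2 t = r2 at *
    have := h1.ne'
    have := h2.ne'
    field_simp
    push_cast
    ring
  intro t₁ h₁ t₂ h₂
  exact isOpen_Ioo.is_const_of_deriv_eq_zero isPreconnected_Ioo
    (fun t ht => (key t ht).differentiableAt.differentiableWithinAt)
    (fun t ht => (key t ht).deriv) h₁ h₂
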